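/- Quadrature error for the weight ψ₂(t) = sin²(t/2)log(sin²(t/2)): with Ψ₂φ(s) = ∫₀^{2π} ψ₂(s-t)a(s,t)φ(t)dt and Ψ₂,Nφ(s) = ∫₀^{2π} ψ₂(s-t)P_N[a(s,·)φ](t)dt for smooth biperiodic a, one has for p ≥ 3, q ≥ -3, p+q > 1/2: ‖(Ψ₂ - Ψ₂,N)φ‖_p ≤ C N^{-q-3}‖φ‖_{p+q}, and for 0 ≤ p ≤ 3: ‖(Ψ₂ - Ψ₂,N)φ‖_p ≤ C N^{-p-q}‖φ‖_{p+q}. -/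

import Mathlib

open scoped Real

/-- Sobolev norm of order `p` of a Fourier coefficient sequence. -/
noncomputable def sobNorm (p : ℝ) (c : ℤ → ℂ) : ℝ :=
  Real.sqrt (‖c 0‖ ^ 2 + ∑' n : {n : ℤ // n ≠ 0}, |(n.1 : ℝ)| ^ (2 * p) * ‖c n.1‖ ^ 2)

/-- The `n`-th Fourier coefficient of a `2π`-periodic function. -/
noncomputable def fcoeff (f : ℝ → ℂ) (n : ℤ) : ℂ :=
  (1 / (2 * (π : ℂ))) * ∫ t in (0:ℝ)..(2 * π), f t * Complex.exp (-(Complex.I * n * t))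

/-- Sobolev norm of order `p` of a `2π`-periodic function. -/
noncomputable def sobNormF (p : ℝ) (f : ℝ → ℂ) : ℝ := sobNorm p (fcoeff f)

/-- The trigonometric interpolant `P_N g` at the `2N` equidistant nodes `jπ/N`. -/
noncomputable def trigInterp (N : ℕ) (g : ℝ → ℂ) : ℝ → ℂ := fun t =>
  ∑ n ∈ Finset.Icc (-(N : ℤ) + 1) (N : ℤ),
    ((1 / (2 * (N : ℂ))) *
        ∑ m ∈ Finset.range (2 * N),
          g (m * π / N) * Complex.exp (-(Complex.I * n * (m * π / N)))) *
      Complex.exp (Complex.I * n * t)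

/-- The weight `ψ₂(t) = sin²(t/2) log(sin²(t/2))`. -/
noncomputable def psi2 : ℝ → ℂ := fun t =>
  ((Real.sin (t / 2) ^ 2 * Real.log (Real.sin (t / 2) ^ 2) : ℝ) : ℂ)

section

open MeasureTheory Set
open scoped ENNReal

/-- The Fourier mode `t ↦ exp (i n t)`. -/
noncomputable def expMode (n : ℤ) (t : ℝ) : ℂ := Complex.exp (Complex.I * n * t)

lemma continuous_expMode (n : ℤ) : Continuous (expMode n) := by
  unfold expMode; fun_prop

@[fun_prop]
lemma Continuous.expMode {X : Type*} [TopologicalSpace X] (n : ℤ) {f : X → ℝ}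
    (hf : Continuous f) : Continuous fun x => expMode n (f x) :=
  (continuous_expMode n).comp hf

@[simp]
lemma norm_expMode (n : ℤ) (t : ℝ) : ‖expMode n t‖ = 1 := by
  have : Complex.I * n * t = ((n * t : ℝ) : ℂ) * Complex.I := by push_cast; ring
  rw [expMode, this, Complex.norm_exp_ofReal_mul_I]

@[simp]
lemma expMode_zero (t : ℝ) : expMode 0 t = 1 := by simp [expMode]

@[simp]
lemma expMode_apply_zero (n : ℤ) : expMode n 0 = 1 := by simp [expMode]

lemma expMode_add (m n : ℤ) (t : ℝ) : expMode (m + n) t = expMode m t * expMode n t := by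
  rw [expMode, expMode, expMode, ← Complex.exp_add]; congr 1; push_cast; ring

lemma expMode_apply_add (n : ℤ) (s t : ℝ) : expMode n (s + t) = expMode n s * expMode n t := by
  rw [expMode, expMode, expMode, ← Complex.exp_add]; congr 1; push_cast; ring

@[simp]
lemma expMode_two_pi (n : ℤ) : expMode n (2 * π) = 1 := by
  rw [expMode, Complex.exp_eq_one_iff]
  exact ⟨n, by push_cast; ring⟩

lemma expMode_periodic (n : ℤ) : Function.Periodic (expMode n) (2 * π) := fun t => by
  rw [expMode_apply_add, expMode_two_pi, mul_one]

lemma fcoeff_eq (f : ℝ → ℂ) (n : ℤ) :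
    fcoeff f n = (1 / (2 * (π : ℂ))) * ∫ t in (0:ℝ)..(2 * π), f t * expMode (-n) t := by
  simp [fcoeff, expMode]

lemma hasDerivAt_expMode (n : ℤ) (t : ℝ) :
    HasDerivAt (expMode n) (Complex.I * n * expMode n t) t := by
  unfold expMode
  have h : HasDerivAt (fun t : ℝ => Complex.I * n * (t : ℂ)) (Complex.I * n) t := by
    simpa using (Complex.ofRealCLM.hasDerivAt (x := t)).const_mul (Complex.I * n)
  simpa [mul_comm] using h.cexp

lemma fcoeff_expMode_mul (k : ℤ) (f : ℝ → ℂ) (m : ℤ) :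
    fcoeff (fun t => expMode k t * f t) m = fcoeff f (m - k) := by
  rw [fcoeff_eq, fcoeff_eq]
  congr 2; ext t
  rw [show -(m - k) = -m + k by ring, expMode_add]; ring

lemma fcoeff_one (m : ℤ) : fcoeff (fun _ => 1) m = if m = 0 then 1 else 0 := by
  rw [fcoeff_eq]
  have hpi : (π : ℂ) ≠ 0 := by exact_mod_cast Real.pi_ne_zero
  split_ifs with h
  · subst h; simp; field_simp
  · have hm : Complex.I * ((-m : ℤ) : ℂ) ≠ 0 := by
      simp [h]
    have : ∀ t ∈ uIcc (0:ℝ) (2 * π),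
        HasDerivAt (fun t => (Complex.I * ((-m : ℤ) : ℂ))⁻¹ * expMode (-m) t)
          (1 * expMode (-m) t) t := fun t _ => by
      convert! (hasDerivAt_expMode (-m) t).const_mul (Complex.I * ((-m : ℤ) : ℂ))⁻¹ using 1
      rw [inv_mul_cancel_left₀ hm, one_mul]
    rw [intervalIntegral.integral_eq_sub_of_hasDerivAt this
      (Continuous.intervalIntegrable (by fun_prop) _ _)]
    simp

lemma fcoeff_expMode (k m : ℤ) : fcoeff (expMode k) m = if m = k then 1 else 0 := by
  have := fcoeff_expMode_mul k (fun _ => 1) m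
  simp only [mul_one, fcoeff_one, sub_eq_zero] at this
  exact this

lemma norm_fcoeff_le {f : ℝ → ℂ} {B : ℝ} (hf : ∀ t, ‖f t‖ ≤ B) (n : ℤ) : ‖fcoeff f n‖ ≤ B := by
  have h := intervalIntegral.norm_integral_le_of_norm_le_const (a := 0) (b := 2 * π) (C := B)
    (f := fun t => f t * expMode (-n) t) (fun t _ => by simpa using hf t)
  have hpi := Real.pi_pos
  rw [fcoeff_eq, norm_mul]
  have h2 : ‖(1 / (2 * (π : ℂ)))‖ = 1 / (2 * π) := by
    simp [abs_of_pos hpi]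
  rw [h2]
  rw [sub_zero, abs_of_pos (by positivity)] at h
  calc _ ≤ 1 / (2 * π) * (B * (2 * π)) := by gcongr
    _ = B := by field_simp

lemma hasSum_intervalIntegral_of_le {ι : Type*} [Countable ι] {F : ι → ℝ → ℂ} {f : ℝ → ℂ}
    {b : ι → ℝ} (hF : ∀ i, Continuous (F i)) (hb : Summable b) (hFb : ∀ i t, ‖F i t‖ ≤ b i)
    (h : ∀ t, HasSum (fun i => F i t) (f t)) :
    HasSum (fun i => ∫ t in (0:ℝ)..(2 * π), F i t) (∫ t in (0:ℝ)..(2 * π), f t) :=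
  intervalIntegral.hasSum_integral_of_dominated_convergence (fun i _ => b i)
    (fun i => (hF i).aestronglyMeasurable) (fun i => by simp [hFb]) (by simp [hb])
    (by simp) (by simp [h])

lemma hasSum_fcoeff_of_le {ι : Type*} [Countable ι] {F : ι → ℝ → ℂ} {f : ℝ → ℂ}
    {b : ι → ℝ} (hF : ∀ i, Continuous (F i)) (hb : Summable b) (hFb : ∀ i t, ‖F i t‖ ≤ b i)
    (h : ∀ t, HasSum (fun i => F i t) (f t)) (n : ℤ) :
    HasSum (fun i => fcoeff (F i) n) (fcoeff f n) := by
  simp_rw [fcoeff_eq]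
  refine HasSum.mul_left _ (hasSum_intervalIntegral_of_le (fun i => ?_) hb (fun i t => ?_)
    fun t => (h t).mul_right _)
  · have := hF i
    fun_prop
  · simpa using hFb i t

lemma fcoeff_sub {f g : ℝ → ℂ} (hf : Continuous f) (hg : Continuous g) (n : ℤ) :
    fcoeff (fun t => f t - g t) n = fcoeff f n - fcoeff g n := by
  simp_rw [fcoeff_eq, sub_mul]
  rw [intervalIntegral.integral_sub, mul_sub] <;>
    exact Continuous.intervalIntegrable (by fun_prop) _ _

lemma fcoeff_const_mul (c : ℂ) (f : ℝ → ℂ) (n : ℤ) :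
    fcoeff (fun t => c * f t) n = c * fcoeff f n := by
  simp_rw [fcoeff_eq, mul_assoc]
  rw [intervalIntegral.integral_const_mul]; ring

lemma fcoeff_finset_sum {ι : Type*} (s : Finset ι) {F : ι → ℝ → ℂ} (hF : ∀ i, Continuous (F i))
    (n : ℤ) : fcoeff (fun t => ∑ i ∈ s, F i t) n = ∑ i ∈ s, fcoeff (F i) n := by
  simp_rw [fcoeff_eq, Finset.sum_mul]
  rw [intervalIntegral.integral_finsetSum, Finset.mul_sum]
  exact fun i _ => Continuous.intervalIntegrable (by have := hF i; fun_prop) _ _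

lemma fcoeff_deriv {f f' : ℝ → ℂ} (hf : ∀ t, HasDerivAt f (f' t) t) (hf' : Continuous f')
    (hper : Function.Periodic f (2 * π)) (n : ℤ) :
    fcoeff f' n = Complex.I * n * fcoeff f n := by
  have h := intervalIntegral.integral_mul_deriv_eq_deriv_mul (a := 0) (b := 2 * π)
    (u := expMode (-n)) (v := f) (fun t _ => hasDerivAt_expMode (-n) t) (fun t _ => hf t)
    (Continuous.intervalIntegrable (by fun_prop) _ _) (hf'.intervalIntegrable _ _)
  have h0 : f (2 * π) = f 0 := by simpa using hper 0
  have h1 : ∫ t in (0:ℝ)..(2 * π), Complex.I * ((-n : ℤ) : ℂ) * expMode (-n) t * f t =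
      Complex.I * ((-n : ℤ) : ℂ) * ∫ t in (0:ℝ)..(2 * π), f t * expMode (-n) t := by
    rw [← intervalIntegral.integral_const_mul]
    congr 1; ext t; ring
  rw [fcoeff_eq, fcoeff_eq]
  simp_rw [mul_comm (f' _), h, h1, h0]
  simp; ring

lemma hasSum_fcoeff {f : ℝ → ℂ} (hf : Continuous f) (hper : Function.Periodic f (2 * π))
    (hs : Summable fun n => ‖fcoeff f n‖) (t : ℝ) :
    HasSum (fun n => fcoeff f n * expMode n t) (f t) := by
  have : Fact (0 < 2 * π) := ⟨by positivity⟩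
  have hpi : (π : ℂ) ≠ 0 := by exact_mod_cast Real.pi_ne_zero
  have hmode : ∀ (n : ℤ) (t : ℝ), fourier n (t : AddCircle (2 * π)) = expMode n t := fun n t => by
    rw [fourier_coe_apply, expMode]; congr 1; push_cast; field_simp
  let g : C(AddCircle (2 * π), ℂ) := ⟨hper.lift, continuous_coinduced_dom.mpr hf⟩
  have hg : ∀ t : ℝ, g t = f t := fun t => hper.lift_coe t
  have hc : ∀ n, fourierCoeff g n = fcoeff f n := fun n => by
    rw [fourierCoeff_eq_intervalIntegral _ n 0, fcoeff_eq]
    simp only [hg, hmode, zero_add, smul_eq_mul, Complex.real_smul, mul_comm (expMode _ _)]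
    push_cast; rfl
  have := has_pointwise_sum_fourier_series_of_summable (f := g)
    (by simpa only [funext hc] using hs.of_norm) (t : AddCircle (2 * π))
  simpa only [hc, hmode, hg, smul_eq_mul] using this

lemma integral_integral_swap_of_continuous {F : ℝ → ℝ → ℂ} (hF : Continuous F.uncurry)
    (a b c d : ℝ) :
    ∫ x in a..b, ∫ y in c..d, F x y = ∫ y in c..d, ∫ x in a..b, F x y := by
  refine intervalIntegral_intervalIntegral_swap ?_
  exact (hF.continuousOn.integrableOn_compact (isCompact_uIcc.prod isCompact_uIcc)).mono_set
    (prod_mono uIoc_subset_uIcc uIoc_subset_uIcc)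

lemma fcoeff_swap {a : ℝ → ℝ → ℂ} (ha : Continuous a.uncurry) (j k : ℤ) :
    fcoeff (fun s => fcoeff (a s) k) j = fcoeff (fun t => fcoeff (fun s => a s t) j) k := by
  simp_rw [fcoeff_eq, mul_assoc, ← intervalIntegral.integral_const_mul,
    ← intervalIntegral.integral_mul_const, ← intervalIntegral.integral_const_mul]
  rw [integral_integral_swap_of_continuous]
  · congr 1; ext t; congr 1; ext s; ring
  · have := ha
    unfold Function.uncurry at *
    fun_prop

lemma fcoeff_convolution {f h : ℝ → ℂ} (hf : Continuous f) (hfper : Function.Periodic f (2 * π))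
    (hh : Continuous h) (n : ℤ) :
    fcoeff (fun s => ∫ t in (0:ℝ)..(2 * π), f (s - t) * h t) n =
      2 * π * fcoeff f n * fcoeff h n := by
  have hpi : (π : ℂ) ≠ 0 := by exact_mod_cast Real.pi_ne_zero
  have key : ∀ t, ∫ s in (0:ℝ)..(2 * π), f (s - t) * h t * expMode (-n) s =
      (h t * expMode (-n) t) * ∫ s in (0:ℝ)..(2 * π), f s * expMode (-n) s := fun t => by
    have hp : Function.Periodic (fun s => f s * expMode (-n) s) (2 * π) :=
      hfper.mul (expMode_periodic _)
    have h1 := hp.intervalIntegral_add_eq 0 (0 - t)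
    rw [zero_add, show 0 - t + 2 * π = 2 * π - t by ring] at h1
    rw [h1, ← intervalIntegral.integral_comp_sub_right (fun s => f s * expMode (-n) s) t,
      ← intervalIntegral.integral_const_mul]
    congr 1; ext s
    have : expMode (-n) s = expMode (-n) (s - t) * expMode (-n) t := by
      rw [← expMode_apply_add, sub_add_cancel]
    rw [this]; ring
  simp_rw [fcoeff_eq, ← intervalIntegral.integral_mul_const]
  rw [integral_integral_swap_of_continuous]
  · simp_rw [key, intervalIntegral.integral_mul_const]
    field_simp
  · unfold Function.uncurry
    fun_prop

lemma continuous_psi2 : Continuous psi2 := by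
  unfold psi2
  exact Complex.continuous_ofReal.comp
    (Real.continuous_mul_log.comp (f := fun t : ℝ => Real.sin (t / 2) ^ 2) (by fun_prop))

lemma psi2_periodic : Function.Periodic psi2 (2 * π) := fun t => by
  simp [psi2, show (t + 2 * π) / 2 = t / 2 + π by ring, Real.sin_add_pi]

lemma psi2_neg (t : ℝ) : psi2 (-t) = psi2 t := by
  simp [psi2, neg_div]

/-- The quotient `sin (k t) / sin (t / 2)`. -/
noncomputable def sinQuot (k : ℕ) (t : ℝ) : ℝ :=
  ∑ i ∈ Finset.range k, 2 * Real.cos ((i + 1 / 2) * t)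

lemma continuous_sinQuot (k : ℕ) : Continuous (sinQuot k) := by
  unfold sinQuot; fun_prop

lemma sin_half_mul_sinQuot (k : ℕ) (t : ℝ) :
    Real.sin (t / 2) * sinQuot k t = Real.sin (k * t) := by
  induction k with
  | zero => simp [sinQuot]
  | succ k ih =>
    rw [sinQuot, Finset.sum_range_succ, ← sinQuot, mul_add, ih]
    have h1 : ((k + 1 : ℕ) : ℝ) * t = (k + 1 / 2) * t + t / 2 := by push_cast; ring
    have h2 : (k : ℝ) * t = (k + 1 / 2) * t - t / 2 := by ring
    rw [h1, h2, Real.sin_add, Real.sin_sub]; ring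

lemma integral_cos_nat_mul {k : ℕ} (hk : k ≠ 0) :
    ∫ t in (0:ℝ)..(2 * π), Real.cos (k * t) = 0 := by
  have hk' : (k : ℝ) ≠ 0 := by exact_mod_cast hk
  rw [intervalIntegral.integral_comp_mul_left _ hk', integral_cos]
  have h := Real.sin_nat_mul_pi (2 * k)
  push_cast at h
  simp [show (k : ℝ) * (2 * π) = 2 * k * π by ring, h]

lemma integral_sinQuot_mul_cos {k : ℕ} (hk : k ≠ 0) :
    ∫ t in (0:ℝ)..(2 * π), sinQuot k t * Real.cos (t / 2) = 2 * π := by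
  obtain ⟨k, rfl⟩ := Nat.exists_eq_succ_of_ne_zero hk
  clear hk
  have step : ∀ k : ℕ, ∫ t in (0:ℝ)..(2 * π), sinQuot (k + 1) t * Real.cos (t / 2) =
      (∫ t in (0:ℝ)..(2 * π), sinQuot k t * Real.cos (t / 2)) +
        ∫ t in (0:ℝ)..(2 * π), Real.cos (k * t) := fun k => by
    have := continuous_sinQuot k
    have h0 : ∫ t in (0:ℝ)..(2 * π), Real.cos ((k + 1 : ℕ) * t) = 0 :=
      integral_cos_nat_mul k.succ_ne_zero
    have e : ∀ t, sinQuot (k + 1) t * Real.cos (t / 2) =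
        sinQuot k t * Real.cos (t / 2) + Real.cos (k * t) + Real.cos ((k + 1 : ℕ) * t) :=
      fun t => by
        rw [sinQuot, Finset.sum_range_succ, ← sinQuot]
        have h1 : ((k + 1 : ℕ) : ℝ) * t = (k + 1 / 2) * t + t / 2 := by push_cast; ring
        have h2 : (k : ℝ) * t = (k + 1 / 2) * t - t / 2 := by ring
        rw [h1, h2, Real.cos_add, Real.cos_sub]; ring
    simp_rw [e]
    rw [intervalIntegral.integral_add, intervalIntegral.integral_add, h0, add_zero]
    all_goals exact Continuous.intervalIntegrable (by fun_prop) _ _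
  induction k with
  | zero => rw [step]; simp [sinQuot]
  | succ k ih => rw [step, ih, integral_cos_nat_mul k.succ_ne_zero, add_zero]

/-- An antiderivative of `sin t * sin (m t)`, divided by `sin (t / 2)`. -/
noncomputable def sinSinPrim (m : ℕ) (t : ℝ) : ℝ :=
  (sinQuot (m - 1) t / (m - 1) - sinQuot (m + 1) t / (m + 1)) / 2

lemma continuous_sinSinPrim (m : ℕ) : Continuous (sinSinPrim m) := by
  have h1 := continuous_sinQuot (m - 1)
  have h2 := continuous_sinQuot (m + 1)
  unfold sinSinPrim; fun_prop

lemma integral_sinSinPrim_mul_cos {m : ℕ} (hm : 2 ≤ m) :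
    ∫ t in (0:ℝ)..(2 * π), sinSinPrim m t * Real.cos (t / 2) = 2 * π / (m ^ 2 - 1) := by
  have h1 := continuous_sinQuot (m - 1)
  have h2 := continuous_sinQuot (m + 1)
  have hm' : (2 : ℝ) ≤ m := by exact_mod_cast hm
  have e : ∀ t, sinSinPrim m t * Real.cos (t / 2) =
      (2 * ((m:ℝ) - 1))⁻¹ * (sinQuot (m - 1) t * Real.cos (t / 2)) -
      (2 * ((m:ℝ) + 1))⁻¹ * (sinQuot (m + 1) t * Real.cos (t / 2)) := fun t => by
    have : (m:ℝ) - 1 ≠ 0 := by linarith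
    have : (m:ℝ) + 1 ≠ 0 := by linarith
    rw [sinSinPrim]; field_simp
  simp_rw [e]
  rw [intervalIntegral.integral_sub, intervalIntegral.integral_const_mul,
    intervalIntegral.integral_const_mul, integral_sinQuot_mul_cos (by omega),
    integral_sinQuot_mul_cos (by omega)]
  · have : (m:ℝ) - 1 ≠ 0 := by linarith
    have : (m:ℝ) + 1 ≠ 0 := by linarith
    have : (m:ℝ) ^ 2 - 1 ≠ 0 := by nlinarith
    field_simp; ring
  all_goals exact Continuous.intervalIntegrable (by fun_prop) _ _

lemma hasDerivAt_sin_half_mul_sinSinPrim {m : ℕ} (hm : 2 ≤ m) (t : ℝ) :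
    HasDerivAt (fun t => Real.sin (t / 2) * sinSinPrim m t) (Real.sin t * Real.sin (m * t)) t := by
  have hm' : (2 : ℝ) ≤ m := by exact_mod_cast hm
  have n1 : (m:ℝ) - 1 ≠ 0 := by linarith
  have n2 : (m:ℝ) + 1 ≠ 0 := by linarith
  have e : (fun t => Real.sin (t / 2) * sinSinPrim m t) = fun t =>
      (Real.sin (((m:ℝ) - 1) * t) / (m - 1) - Real.sin (((m:ℝ) + 1) * t) / (m + 1)) / 2 := by
    ext t
    have h1 := sin_half_mul_sinQuot (m - 1) t
    have h2 := sin_half_mul_sinQuot (m + 1) t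
    rw [Nat.cast_sub (by omega)] at h1
    push_cast at h1 h2
    rw [sinSinPrim, ← h1, ← h2]; ring
  rw [e]
  have d : ∀ c : ℝ, HasDerivAt (fun t => Real.sin (c * t)) (Real.cos (c * t) * c) t := fun c => by
    simpa using ((hasDerivAt_id t).const_mul c).sin
  have := (((d (m - 1)).div_const ((m:ℝ) - 1)).sub ((d (m + 1)).div_const ((m:ℝ) + 1))).div_const 2
  convert! this using 1
  rw [mul_div_cancel_right₀ _ n1, mul_div_cancel_right₀ _ n2, sub_mul, add_mul, one_mul,
    Real.cos_sub, Real.cos_add]; ring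

lemma integral_psi2_mul_cos {m : ℕ} (hm : 2 ≤ m) :
    ∫ t in (0:ℝ)..(2 * π), Real.sin (t / 2) ^ 2 * Real.log (Real.sin (t / 2) ^ 2) *
      Real.cos (m * t) = π / (m * (m ^ 2 - 1)) := by
  have hm' : (2 : ℝ) ≤ m := by exact_mod_cast hm
  have n0 : (m:ℝ) ≠ 0 := by linarith
  have n1 : (m:ℝ) ^ 2 - 1 ≠ 0 := by nlinarith
  have hc := continuous_sinSinPrim m
  set P : ℝ → ℝ := fun t => Real.sin (t / 2) ^ 2 * Real.log (Real.sin (t / 2) ^ 2) with hP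
  set Q : ℝ → ℝ := fun t => Real.sin (t / 2) * Real.log (Real.sin (t / 2)) with hQ
  set S : ℝ → ℝ := fun t => Real.sin (t / 2) with hS
  have hScont : Continuous S := by fun_prop
  have hPcont : Continuous P :=
    Real.continuous_mul_log.comp (f := fun t : ℝ => Real.sin (t / 2) ^ 2) (by fun_prop)
  have hQcont : Continuous Q := Real.continuous_mul_log.comp hScont
  set F : ℝ → ℝ := fun t => P t * Real.sin (m * t) / m -
    (2 * (Q t * sinSinPrim m t) + S t * sinSinPrim m t) / (2 * m) with hF
  have hFcont : Continuous F := by fun_prop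
  have hderiv : ∀ t ∈ Ioo 0 (2 * π), HasDerivAt F
      (P t * Real.cos (m * t) - sinSinPrim m t * Real.cos (t / 2) / (2 * m)) t := fun t ht => by
    have hpos : 0 < Real.sin (t / 2) :=
      Real.sin_pos_of_pos_of_lt_pi (by linarith [ht.1]) (by linarith [ht.2])
    have dS : HasDerivAt S (Real.cos (t / 2) * (1 / 2)) t :=
      ((hasDerivAt_id t).div_const 2).sin
    have dL := dS.log hpos.ne'
    have dm : HasDerivAt (fun t => Real.sin (m * t)) (Real.cos (m * t) * m) t := by
      simpa using ((hasDerivAt_id t).const_mul (m:ℝ)).sin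
    have dH := hasDerivAt_sin_half_mul_sinSinPrim hm t
    have eF : F = fun t => S t ^ 2 * (2 * Real.log (S t)) * Real.sin (m * t) / m -
        (2 * Real.log (S t) + 1) * (S t * sinSinPrim m t) / (2 * m) := by
      ext t; simp only [hF, hP, hQ, hS, Real.log_pow]; push_cast; ring
    rw [eF]
    have := ((((dS.pow 2).mul (dL.const_mul 2)).mul dm).div_const (m:ℝ)).sub
      ((((dL.const_mul 2).add_const 1).mul dH).div_const (2 * (m:ℝ)))
    convert! this using 1
    have hst : Real.sin t = 2 * Real.sin (t / 2) * Real.cos (t / 2) := by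
      rw [← Real.sin_two_mul]; congr 1; ring
    simp only [hP, hS, Real.log_pow, hst, Pi.mul_apply, Pi.pow_apply]
    have := hpos.ne'
    field_simp
    push_cast
    ring
  have hint := intervalIntegral.integral_eq_sub_of_hasDerivAt_of_le (by positivity)
    hFcont.continuousOn hderiv (Continuous.intervalIntegrable (by fun_prop) _ _)
  have hend : F (2 * π) - F 0 = 0 := by
    simp [hF, hP, hQ, hS]
  rw [hend, intervalIntegral.integral_sub, intervalIntegral.integral_div,
    integral_sinSinPrim_mul_cos hm] at hint
  · rw [sub_eq_zero.mp hint]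
    field_simp
  all_goals exact Continuous.intervalIntegrable (by fun_prop) _ _


lemma fcoeff_psi2_neg (n : ℤ) : fcoeff psi2 (-n) = fcoeff psi2 n := by
  rw [fcoeff_eq, fcoeff_eq]
  congr 1
  have h := intervalIntegral.integral_comp_sub_left (a := 0) (b := 2 * π)
    (fun t => psi2 t * expMode (-n) t) (2 * π)
  rw [sub_self, sub_zero] at h
  rw [← h]
  congr 1; ext t
  have h1 : psi2 (2 * π - t) = psi2 t := by
    rw [sub_eq_neg_add, psi2_periodic, psi2_neg]
  have h2 : expMode (-n) (2 * π - t) = expMode (- -n) t := by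
    rw [sub_eq_neg_add, expMode_periodic, expMode, expMode]; congr 1; push_cast; ring
  rw [h1, h2]

lemma fcoeff_psi2 {m : ℕ} (hm : 2 ≤ m) :
    fcoeff psi2 m = ((1 / (2 * (m * (m ^ 2 - 1))) : ℝ) : ℂ) := by
  have hm' : (2 : ℝ) ≤ m := by exact_mod_cast hm
  have n0 : (m:ℝ) ≠ 0 := by linarith
  have n1 : (m:ℝ) ^ 2 - 1 ≠ 0 := by nlinarith
  have hc := continuous_psi2
  have h : fcoeff psi2 m = (fcoeff psi2 m + fcoeff psi2 (-m)) / 2 := by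
    rw [fcoeff_psi2_neg]; ring
  rw [h, fcoeff_eq, fcoeff_eq, ← mul_add, ← intervalIntegral.integral_add]
  · have e : ∀ t : ℝ, psi2 t * expMode (-m) t + psi2 t * expMode (- -m) t =
        ((2 * (Real.sin (t / 2) ^ 2 * Real.log (Real.sin (t / 2) ^ 2) *
          Real.cos (m * t)) : ℝ) : ℂ) := fun t => by
      have e1 : Complex.cos (m * t) = (expMode (-m) t + expMode (- -m) t) / 2 := by
        rw [Complex.cos, expMode, expMode, add_comm]
        congr 3 <;> (push_cast; ring)
      rw [← mul_add]
      push_cast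
      rw [e1, psi2]; push_cast; ring
    simp_rw [e]
    rw [intervalIntegral.integral_ofReal, intervalIntegral.integral_const_mul,
      integral_psi2_mul_cos hm]
    have hpi : (π : ℂ) ≠ 0 := by exact_mod_cast Real.pi_ne_zero
    have n0' : (m : ℂ) ≠ 0 := by exact_mod_cast n0
    have n1' : (m : ℂ) ^ 2 - 1 ≠ 0 := by exact_mod_cast n1
    push_cast
    field_simp
  all_goals exact Continuous.intervalIntegrable (by fun_prop) _ _

/-- The Japanese-bracket type weight `max 1 |n|`. -/
noncomputable def freqWeight (n : ℤ) : ℝ := max 1 |(n : ℝ)|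

lemma one_le_freqWeight (n : ℤ) : 1 ≤ freqWeight n := le_max_left _ _

lemma freqWeight_pos (n : ℤ) : 0 < freqWeight n := zero_lt_one.trans_le (one_le_freqWeight n)

lemma freqWeight_neg (n : ℤ) : freqWeight (-n) = freqWeight n := by simp [freqWeight]

@[simp]
lemma freqWeight_zero : freqWeight 0 = 1 := by simp [freqWeight]

lemma freqWeight_of_ne_zero {n : ℤ} (hn : n ≠ 0) : freqWeight n = |(n : ℝ)| :=
  max_eq_right (by exact_mod_cast Int.one_le_abs hn)

lemma freqWeight_add_le (m n : ℤ) : freqWeight (m + n) ≤ 2 * freqWeight m * freqWeight n := by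
  have h1 := one_le_freqWeight m
  have h2 := one_le_freqWeight n
  have h3 : |(m : ℝ)| ≤ freqWeight m := le_max_right _ _
  have h4 : |(n : ℝ)| ≤ freqWeight n := le_max_right _ _
  refine max_le (by nlinarith) ?_
  push_cast
  nlinarith [abs_add_le (m : ℝ) n]

lemma exists_norm_fcoeff_psi2_le :
    ∃ C > 0, ∀ n, ‖fcoeff psi2 n‖ ≤ C * freqWeight n ^ (-3 : ℝ) := by
  refine ⟨1 + ‖fcoeff psi2 0‖ + ‖fcoeff psi2 1‖, by positivity, fun n => ?_⟩
  have h : ∀ m : ℕ, ‖fcoeff psi2 m‖ ≤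
      (1 + ‖fcoeff psi2 0‖ + ‖fcoeff psi2 1‖) * freqWeight m ^ (-3 : ℝ) := fun m => by
    obtain rfl | rfl | hm : m = 0 ∨ m = 1 ∨ 2 ≤ m := by omega
    · simp; linarith [norm_nonneg (fcoeff psi2 0), norm_nonneg (fcoeff psi2 1)]
    · simp [freqWeight]; linarith [norm_nonneg (fcoeff psi2 0)]
    · have hm' : (2 : ℝ) ≤ m := by exact_mod_cast hm
      have hw : freqWeight m = m := by
        rw [freqWeight_of_ne_zero (by omega)]; simp
      have hp : 0 < (m:ℝ) ^ 2 - 1 := by nlinarith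
      rw [hw, Real.rpow_neg (by positivity), fcoeff_psi2 hm, Complex.norm_real,
        Real.norm_of_nonneg (by positivity)]
      calc 1 / (2 * (m * ((m:ℝ) ^ 2 - 1))) ≤ 1 * ((m:ℝ) ^ (3:ℝ))⁻¹ := by
            rw [one_div, one_mul]
            apply inv_anti₀ (by positivity)
            rw [show (3 : ℝ) = (3 : ℕ) by norm_num, Real.rpow_natCast]
            nlinarith
        _ ≤ _ := by
            gcongr
            linarith [norm_nonneg (fcoeff psi2 0), norm_nonneg (fcoeff psi2 1)]
  obtain ⟨m, rfl | rfl⟩ := n.eq_nat_or_neg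
  · exact h m
  · rw [fcoeff_psi2_neg, freqWeight_neg]; exact h m

lemma ENNReal.tsum_mul_sq_le {ι : Type*} (f g : ι → ℝ≥0∞) :
    (∑' i, f i * g i) ^ 2 ≤ (∑' i, f i ^ 2) * ∑' i, g i ^ 2 := by
  let _ : MeasurableSpace ι := ⊤
  have h := ENNReal.lintegral_mul_le_Lp_mul_Lq (Measure.count : Measure ι)
    Real.HolderConjugate.two_two (measurable_from_top (f := f)).aemeasurable
    (measurable_from_top (f := g)).aemeasurable
  simp only [lintegral_count, Pi.mul_apply, ENNReal.rpow_two] at h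
  calc _ ≤ ((∑' i, f i ^ 2) ^ (1 / 2 : ℝ) * (∑' i, g i ^ 2) ^ (1 / 2 : ℝ)) ^ 2 := by gcongr
    _ = _ := by
      rw [mul_pow, ← ENNReal.rpow_two, ← ENNReal.rpow_two, ← ENNReal.rpow_mul, ← ENNReal.rpow_mul]
      norm_num

lemma ENNReal.tsum_mul_sq_le_tsum_mul_tsum {ι : Type*} (a x : ι → ℝ≥0∞) :
    (∑' i, a i * x i) ^ 2 ≤ (∑' i, a i) * ∑' i, a i * x i ^ 2 := by
  have h : ∀ i, (a i ^ (1 / 2 : ℝ)) ^ 2 = a i := fun i => by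
    rw [← ENNReal.rpow_two, ← ENNReal.rpow_mul]; norm_num
  convert ENNReal.tsum_mul_sq_le (fun i => a i ^ (1 / 2 : ℝ)) (fun i => a i ^ (1 / 2 : ℝ) * x i)
    using 4 with i i
  · rw [← mul_assoc, ← sq, h]
  · rw [h]
  · rw [mul_pow, h]

/-- The squared Sobolev norm of order `p` of a sequence, as an extended nonnegative real. -/
noncomputable def sobEnergy (p : ℝ) (c : ℤ → ℂ) : ℝ≥0∞ :=
  ∑' n, ENNReal.ofReal (freqWeight n ^ (2 * p)) * ‖c n‖ₑ ^ 2

lemma sobEnergy_mono {p p' : ℝ} (h : p ≤ p') (c : ℤ → ℂ) : sobEnergy p c ≤ sobEnergy p' c := by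
  unfold sobEnergy
  gcongr with n
  exact one_le_freqWeight n

lemma ofReal_freqWeight_mul_enorm_sq (p : ℝ) (c : ℤ → ℂ) (n : ℤ) :
    ENNReal.ofReal (freqWeight n ^ (2 * p)) * ‖c n‖ₑ ^ 2 =
      ENNReal.ofReal (freqWeight n ^ (2 * p) * ‖c n‖ ^ 2) := by
  have := freqWeight_pos n
  rw [ENNReal.ofReal_mul (by positivity), ENNReal.ofReal_pow (by positivity), ofReal_norm]

lemma sobNorm_sq_eq_tsum {p : ℝ} {c : ℤ → ℂ}
    (hs : Summable fun n => freqWeight n ^ (2 * p) * ‖c n‖ ^ 2) :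
    sobNorm p c ^ 2 = ∑' n, freqWeight n ^ (2 * p) * ‖c n‖ ^ 2 := by
  rw [sobNorm, Real.sq_sqrt (add_nonneg (by positivity) (tsum_nonneg fun n => by positivity))]
  have h := hs.tsum_subtype_add_tsum_subtype_compl {0}
  rw [← h, tsum_singleton (0 : ℤ) fun n => freqWeight n ^ (2 * p) * ‖c n‖ ^ 2]
  simp only [freqWeight_zero, Real.one_rpow, one_mul]
  congr 1
  exact tsum_congr fun n => by rw [freqWeight_of_ne_zero n.2]

lemma summable_freqWeight_of_summable {p : ℝ} {c : ℤ → ℂ}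
    (hs : Summable fun n : {n : ℤ // n ≠ 0} => |(n.1 : ℝ)| ^ (2 * p) * ‖c n.1‖ ^ 2) :
    Summable fun n => freqWeight n ^ (2 * p) * ‖c n‖ ^ 2 := by
  have h : Summable fun n : {n : ℤ // n ≠ 0} => freqWeight n.1 ^ (2 * p) * ‖c n.1‖ ^ 2 :=
    hs.congr fun n => by rw [freqWeight_of_ne_zero n.2]
  exact (Set.finite_singleton (0 : ℤ)).summable_compl_iff.mp h

lemma sobEnergy_eq {p : ℝ} {c : ℤ → ℂ}
    (hs : Summable fun n => freqWeight n ^ (2 * p) * ‖c n‖ ^ 2) :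
    sobEnergy p c = ENNReal.ofReal (sobNorm p c ^ 2) := by
  have h0 : ∀ n, 0 ≤ freqWeight n ^ (2 * p) * ‖c n‖ ^ 2 := fun n => by
    have := freqWeight_pos n
    positivity
  rw [sobNorm_sq_eq_tsum hs, ENNReal.ofReal_tsum_of_nonneg h0 hs]
  exact tsum_congr (ofReal_freqWeight_mul_enorm_sq p c)

lemma sobNorm_le_of_sobEnergy_le {p K : ℝ} {c : ℤ → ℂ} (hK : 0 ≤ K)
    (h : sobEnergy p c ≤ ENNReal.ofReal (K ^ 2)) : sobNorm p c ≤ K := by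
  have h0 : ∀ n, 0 ≤ freqWeight n ^ (2 * p) * ‖c n‖ ^ 2 := fun n => by
    have := freqWeight_pos n
    positivity
  have hs : Summable fun n => freqWeight n ^ (2 * p) * ‖c n‖ ^ 2 := by
    have h1 : sobEnergy p c ≠ ∞ := ne_top_of_le_ne_top ENNReal.ofReal_ne_top h
    refine (ENNReal.summable_toReal h1).congr fun n => ?_
    rw [ofReal_freqWeight_mul_enorm_sq, ENNReal.toReal_ofReal (h0 n)]
  rw [sobEnergy_eq hs, ENNReal.ofReal_le_ofReal_iff (by positivity)] at h
  exact le_of_sq_le_sq h hK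

lemma sobEnergy_shift_le {p : ℝ} (hp : 0 ≤ p) (c : ℤ → ℂ) (k : ℤ) :
    sobEnergy p (fun n => c (n - k)) ≤
      ENNReal.ofReal ((2 * freqWeight k) ^ (2 * p)) * sobEnergy p c := by
  have hk := freqWeight_pos k
  rw [sobEnergy, ← (Equiv.addRight k).tsum_eq, sobEnergy, ← ENNReal.tsum_mul_left]
  refine ENNReal.tsum_le_tsum fun n => ?_
  have hn := freqWeight_pos n
  simp only [Equiv.coe_addRight, add_sub_cancel_right]
  rw [← mul_assoc, ← ENNReal.ofReal_mul (by positivity), ← Real.mul_rpow (by positivity) hn.le]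
  gcongr
  · exact (freqWeight_pos _).le
  · linarith [freqWeight_add_le n k]

lemma sobEnergy_le_of_norm_le {p r C : ℝ} {f e : ℤ → ℂ}
    (h : ∀ n, ‖f n‖ ≤ C * freqWeight n ^ (-r) * ‖e n‖) :
    sobEnergy p f ≤ ENNReal.ofReal (C ^ 2) * sobEnergy (p - r) e := by
  rw [sobEnergy, sobEnergy, ← ENNReal.tsum_mul_left]
  refine ENNReal.tsum_le_tsum fun n => ?_
  have hn := freqWeight_pos n
  rw [ofReal_freqWeight_mul_enorm_sq, ofReal_freqWeight_mul_enorm_sq,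
    ← ENNReal.ofReal_mul (by positivity)]
  refine ENNReal.ofReal_le_ofReal ?_
  calc _ ≤ freqWeight n ^ (2 * p) * (C * freqWeight n ^ (-r) * ‖e n‖) ^ 2 := by
        gcongr; exact h n
    _ = C ^ 2 * ((freqWeight n ^ (2 * p) * (freqWeight n ^ (-r)) ^ 2) * ‖e n‖ ^ 2) := by ring
    _ = _ := by
        rw [← Real.rpow_natCast (freqWeight n ^ (-r)), ← Real.rpow_mul hn.le, ← Real.rpow_add hn]
        congr 4; push_cast; ring

lemma sobEnergy_superposition_le {p : ℝ} (hp : 0 ≤ p) {ι : Type*} {α : ι → ℝ≥0∞} {j : ι → ℤ}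
    {D : ι → ℤ → ℂ} {E : ℤ → ℂ} (h : ∀ l, ‖E l‖ₑ ≤ ∑' i, α i * ‖D i (l - j i)‖ₑ) :
    sobEnergy p E ≤ (∑' i, α i) *
      ∑' i, α i * (ENNReal.ofReal ((2 * freqWeight (j i)) ^ (2 * p)) * sobEnergy p (D i)) := by
  calc sobEnergy p E ≤ ∑' l, ENNReal.ofReal (freqWeight l ^ (2 * p)) *
        ((∑' i, α i) * ∑' i, α i * ‖D i (l - j i)‖ₑ ^ 2) := by
        unfold sobEnergy
        gcongr with l
        exact (pow_le_pow_left₀ zero_le (h l) 2).trans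
          (ENNReal.tsum_mul_sq_le_tsum_mul_tsum _ _)
    _ = (∑' i, α i) * ∑' i, α i * sobEnergy p (fun l => D i (l - j i)) := by
        simp_rw [mul_left_comm _ (∑' i, α i), ENNReal.tsum_mul_left, sobEnergy,
          ← ENNReal.tsum_mul_left]
        rw [ENNReal.tsum_comm]
        simp_rw [mul_left_comm]
    _ ≤ _ := by
        gcongr with i
        exact sobEnergy_shift_le hp _ _

lemma sobEnergy_alias_le {r s : ℝ} (hr : 0 ≤ r) (hs : 0 ≤ s) {N : ℕ} (hN : 0 < N)
    {d e : ℤ → ℂ} (hout : ∀ m ∉ Finset.Icc (-(N : ℤ) + 1) N, e m = d m)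
    (hin : ∀ m ∈ Finset.Icc (-(N : ℤ) + 1) N,
      ‖e m‖ₑ ≤ ∑' i : {i : ℤ // i ≠ 0}, ‖d (m + 2 * N * i)‖ₑ) :
    sobEnergy r e ≤ (1 + ∑' i : {i : ℤ // i ≠ 0}, ENNReal.ofReal (|(i.1 : ℝ)| ^ (-(2 * (r + s))))) *
      ENNReal.ofReal ((N : ℝ) ^ (-(2 * s))) * sobEnergy (r + s) d := by
  set σ := r + s with hσ
  set B := Finset.Icc (-(N : ℤ) + 1) N with hB
  set Z := ∑' i : {i : ℤ // i ≠ 0}, ENNReal.ofReal (|(i.1 : ℝ)| ^ (-(2 * σ))) with hZ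
  have hN1 : (1 : ℝ) ≤ N := by exact_mod_cast hN
  have hN0 : (0 : ℝ) < N := by linarith
  set T : ℤ → ℝ≥0∞ := fun m => ENNReal.ofReal (freqWeight m ^ (2 * σ)) * ‖d m‖ₑ ^ 2 with hT
  have bound_out : ∀ m ∉ B, ENNReal.ofReal (freqWeight m ^ (2 * r)) * ‖e m‖ₑ ^ 2 ≤
      ENNReal.ofReal ((N : ℝ) ^ (-(2 * s))) * T m := fun m hm => by
    have hw := freqWeight_pos m
    have hNw : (N : ℝ) ≤ freqWeight m := by
      have : (N : ℤ) ≤ |m| := by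
        simp only [hB, Finset.mem_Icc, not_and, not_le] at hm
        rcases le_total 0 m with h | h
        · rw [abs_of_nonneg h]; omega
        · rw [abs_of_nonpos h]; omega
      exact le_trans (by exact_mod_cast this) (le_max_right _ _)
    rw [hout m hm, hT, ← mul_assoc, ← ENNReal.ofReal_mul (by positivity)]
    gcongr
    calc freqWeight m ^ (2 * r) = freqWeight m ^ (-(2 * s)) * freqWeight m ^ (2 * σ) := by
          rw [← Real.rpow_add hw]; congr 1; rw [hσ]; ring
      _ ≤ _ := mul_le_mul_of_nonneg_right
          (Real.rpow_le_rpow_of_nonpos hN0 hNw (by linarith)) (by positivity)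
  have bound_in : ∀ m ∈ B, ENNReal.ofReal (freqWeight m ^ (2 * r)) * ‖e m‖ₑ ^ 2 ≤
      Z * ENNReal.ofReal ((N : ℝ) ^ (-(2 * s))) *
        ∑' i : {i : ℤ // i ≠ 0}, T (m + 2 * N * i) := fun m hm => by
    have hmem := Finset.mem_Icc.mp hm
    have hw := freqWeight_pos m
    have hmN : |(m : ℝ)| ≤ N := by
      have : |m| ≤ N := abs_le.mpr ⟨by omega, hmem.2⟩
      exact_mod_cast this
    have hwN : freqWeight m ≤ N := max_le hN1 hmN
    have hfar : ∀ i : {i : ℤ // i ≠ 0}, N * |(i.1 : ℝ)| ≤ freqWeight (m + 2 * N * i) := fun i => by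
      have hi : (1 : ℝ) ≤ |(i.1 : ℝ)| := by exact_mod_cast Int.one_le_abs i.2
      refine le_trans ?_ (le_max_right _ _)
      push_cast
      have h1 : |2 * (N : ℝ) * i.1| = 2 * N * |(i.1 : ℝ)| := by
        rw [abs_mul, abs_of_pos (by positivity)]
      have h2 := abs_sub_abs_le_abs_sub (2 * (N : ℝ) * i.1) (-m)
      rw [abs_neg, sub_neg_eq_add, add_comm _ (m : ℝ)] at h2
      nlinarith
    calc _ ≤ ENNReal.ofReal ((N : ℝ) ^ (2 * r)) *
          ((∑' i : {i : ℤ // i ≠ 0}, ENNReal.ofReal ((N * |(i.1 : ℝ)|) ^ (-σ)) ^ 2) *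
            ∑' i : {i : ℤ // i ≠ 0}, T (m + 2 * N * i)) := by
          gcongr
          refine (pow_le_pow_left₀ zero_le ((hin m hm).trans ?_) 2).trans
            ((ENNReal.tsum_mul_sq_le (fun i : {i : ℤ // i ≠ 0} =>
              ENNReal.ofReal ((N * |(i.1 : ℝ)|) ^ (-σ)))
              fun i => ENNReal.ofReal (freqWeight (m + 2 * N * i) ^ σ) *
                ‖d (m + 2 * N * i)‖ₑ).trans_eq ?_)
          · gcongr with i
            have hwi := freqWeight_pos (m + 2 * N * i)
            have hi : 0 < |(i.1 : ℝ)| := abs_pos.mpr (by exact_mod_cast i.2)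
            rw [← mul_assoc, ← ENNReal.ofReal_mul (by positivity)]
            refine le_mul_of_one_le_left zero_le (ENNReal.one_le_ofReal.mpr ?_)
            rw [Real.rpow_neg (by positivity), ← div_eq_inv_mul, one_le_div (by positivity)]
            gcongr
            exact hfar i
          · congr 1
            refine tsum_congr fun i => ?_
            have hwi := freqWeight_pos (m + 2 * N * i)
            rw [hT, mul_pow, ← ENNReal.ofReal_pow (by positivity), ← Real.rpow_natCast,
              ← Real.rpow_mul hwi.le, mul_comm σ]
            norm_num
      _ = _ := by
          rw [← mul_assoc]
          congr 1
          rw [hZ, ← ENNReal.tsum_mul_left, ← ENNReal.tsum_mul_right]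
          refine tsum_congr fun i => ?_
          have hi : 0 < |(i.1 : ℝ)| := abs_pos.mpr (by exact_mod_cast i.2)
          rw [← ENNReal.ofReal_pow (by positivity), ← ENNReal.ofReal_mul (by positivity),
            ← ENNReal.ofReal_mul (by positivity), ← Real.rpow_natCast, ← Real.rpow_mul (by positivity),
            Real.mul_rpow (by positivity) (by positivity), ← mul_assoc, ← Real.rpow_add hN0, mul_comm]
          congr 3 <;> (push_cast; rw [hσ]; ring)
  have hinj : Function.Injective fun x : B × {i : ℤ // i ≠ 0} => (x.1 : ℤ) + 2 * N * x.2 := by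
    rintro ⟨⟨m, hm⟩, i, hi⟩ ⟨⟨m', hm'⟩, i', hi'⟩ h
    simp only [hB, Finset.mem_Icc] at hm hm'
    simp only at h
    have h1 : (2 * N : ℤ) * (i - i') = m' - m := by linarith
    have h2 : i - i' = 0 := by
      by_contra hne
      have h3 : (1 : ℤ) ≤ |i - i'| := Int.one_le_abs hne
      have h4 : |m' - m| < 2 * N := abs_lt.mpr ⟨by omega, by omega⟩
      rw [← h1, abs_mul, abs_of_nonneg (by positivity)] at h4
      nlinarith
    have h5 : m' - m = 0 := by rw [← h1, h2, mul_zero]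
    simp only [Prod.mk.injEq, Subtype.mk.injEq]
    omega
  calc sobEnergy r e
      ≤ ∑' m, (ENNReal.ofReal ((N : ℝ) ^ (-(2 * s))) * T m +
          (B : Set ℤ).indicator (fun m => Z * ENNReal.ofReal ((N : ℝ) ^ (-(2 * s))) *
            ∑' i : {i : ℤ // i ≠ 0}, T (m + 2 * N * i)) m) := by
        refine ENNReal.tsum_le_tsum fun m => ?_
        by_cases hm : m ∈ B
        · rw [indicator_of_mem (by exact_mod_cast hm)]
          exact (bound_in m hm).trans le_add_self
        · exact (bound_out m hm).trans le_self_add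
    _ = ENNReal.ofReal ((N : ℝ) ^ (-(2 * s))) * sobEnergy σ d +
          Z * ENNReal.ofReal ((N : ℝ) ^ (-(2 * s))) *
            ∑' x : B × {i : ℤ // i ≠ 0}, T ((x.1 : ℤ) + 2 * N * x.2) := by
        rw [ENNReal.tsum_add, ENNReal.tsum_mul_left, ← tsum_subtype, ENNReal.tsum_mul_left,
          ENNReal.tsum_prod (f := fun (m : B) (i : {i : ℤ // i ≠ 0}) => T ((m : ℤ) + 2 * N * i))]
        rfl
    _ ≤ ENNReal.ofReal ((N : ℝ) ^ (-(2 * s))) * sobEnergy σ d +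
          Z * ENNReal.ofReal ((N : ℝ) ^ (-(2 * s))) * sobEnergy σ d := by
        gcongr
        exact ENNReal.tsum_comp_le_tsum_of_injective hinj T
    _ = _ := by ring

/-- The `n`-th discrete Fourier coefficient of `g` at the nodes `m π / N`. -/
noncomputable def interpCoeff (N : ℕ) (g : ℝ → ℂ) (n : ℤ) : ℂ :=
  (1 / (2 * (N : ℂ))) * ∑ m ∈ Finset.range (2 * N), g (m * π / N) * expMode (-n) (m * π / N)

lemma trigInterp_eq (N : ℕ) (g : ℝ → ℂ) (t : ℝ) :
    trigInterp N g t =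
      ∑ n ∈ Finset.Icc (-(N : ℤ) + 1) (N : ℤ), interpCoeff N g n * expMode n t := by
  simp [trigInterp, interpCoeff, expMode]

lemma continuous_trigInterp (N : ℕ) (g : ℝ → ℂ) : Continuous (trigInterp N g) := by
  simp_rw [funext (trigInterp_eq N g)]
  fun_prop

lemma norm_interpCoeff_le {N : ℕ} (hN : 0 < N) {g : ℝ → ℂ} {B : ℝ} (hg : ∀ t, ‖g t‖ ≤ B) (n : ℤ) :
    ‖interpCoeff N g n‖ ≤ B := by
  have hN0 : (0 : ℝ) < N := by exact_mod_cast hN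
  rw [interpCoeff, norm_mul]
  calc _ ≤ ‖1 / (2 * (N : ℂ))‖ * ∑ m ∈ Finset.range (2 * N), B := by
        gcongr
        refine (norm_sum_le _ _).trans (Finset.sum_le_sum fun m _ => ?_)
        simpa using hg _
    _ = B := by simp; field_simp

lemma norm_trigInterp_le {N : ℕ} (hN : 0 < N) {g : ℝ → ℂ} {B : ℝ} (hg : ∀ t, ‖g t‖ ≤ B) (t : ℝ) :
    ‖trigInterp N g t‖ ≤ (Finset.Icc (-(N : ℤ) + 1) (N : ℤ)).card * B := by
  rw [trigInterp_eq, ← nsmul_eq_mul, ← Finset.sum_const]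
  refine (norm_sum_le _ _).trans (Finset.sum_le_sum fun n _ => ?_)
  simpa using norm_interpCoeff_le hN hg n

lemma hasSum_interpCoeff {ι : Type*} {F : ι → ℝ → ℂ} {f : ℝ → ℂ}
    (h : ∀ t, HasSum (fun i => F i t) (f t)) (N : ℕ) (n : ℤ) :
    HasSum (fun i => interpCoeff N (F i) n) (interpCoeff N f n) :=
  (hasSum_sum fun _ _ => (h _).mul_right _).mul_left _

lemma hasSum_trigInterp {ι : Type*} {F : ι → ℝ → ℂ} {f : ℝ → ℂ}
    (h : ∀ t, HasSum (fun i => F i t) (f t)) (N : ℕ) (t : ℝ) :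
    HasSum (fun i => trigInterp N (F i) t) (trigInterp N f t) := by
  simp_rw [trigInterp_eq]
  exact hasSum_sum fun n _ => (hasSum_interpCoeff h N n).mul_right _

lemma trigInterp_const_mul (N : ℕ) (c : ℂ) (g : ℝ → ℂ) (t : ℝ) :
    trigInterp N (fun u => c * g u) t = c * trigInterp N g t := by
  simp only [trigInterp_eq, interpCoeff, Finset.mul_sum, Finset.sum_mul]
  refine Finset.sum_congr rfl fun n _ => Finset.sum_congr rfl fun m _ => ?_
  ring

lemma interpCoeff_expMode {N : ℕ} (hN : 0 < N) (l n : ℤ) :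
    interpCoeff N (expMode l) n = if (2 * N : ℤ) ∣ l - n then 1 else 0 := by
  have hN0 : (N : ℂ) ≠ 0 := by exact_mod_cast hN.ne'
  have hpi : (π : ℂ) ≠ 0 := by exact_mod_cast Real.pi_ne_zero
  have e : ∀ m : ℕ, expMode l (m * π / N) * expMode (-n) (m * π / N) =
      expMode (l - n) (π / N) ^ m := fun m => by
    rw [← expMode_add, expMode, expMode, ← Complex.exp_nat_mul]
    congr 1; push_cast; ring
  simp_rw [interpCoeff, e]
  split_ifs with h
  · obtain ⟨i, hi⟩ := h
    have : expMode (l - n) (π / N) = 1 := by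
      rw [hi, expMode, Complex.exp_eq_one_iff]
      exact ⟨i, by push_cast; field_simp⟩
    rw [this]; simp; field_simp
  · have h1 : expMode (l - n) (π / N) ≠ 1 := fun h1 => h <| by
      rw [expMode, Complex.exp_eq_one_iff] at h1
      obtain ⟨i, hi⟩ := h1
      refine ⟨i, ?_⟩
      push_cast at hi
      field_simp at hi
      have hi' : ((l - n : ℤ) : ℂ) = ((2 * N * i : ℤ) : ℂ) := by push_cast; linear_combination hi
      exact_mod_cast hi'
    have h2 : expMode (l - n) (π / N) ^ (2 * N) = 1 := by
      rw [expMode, ← Complex.exp_nat_mul, Complex.exp_eq_one_iff]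
      exact ⟨l - n, by push_cast; field_simp⟩
    rw [geom_sum_eq h1, h2]; simp

lemma hasSum_interpCoeff_alias {N : ℕ} (hN : 0 < N) {g : ℝ → ℂ} {c : ℤ → ℂ}
    (hg : ∀ t, HasSum (fun n => c n * expMode n t) (g t)) (n : ℤ) :
    HasSum (fun i : ℤ => c (n + 2 * N * i)) (interpCoeff N g n) := by
  have h := hasSum_interpCoeff hg N n
  have e : ∀ l, interpCoeff N (fun t => c l * expMode l t) n =
      if (2 * N : ℤ) ∣ l - n then c l else 0 := fun l => by
    have := interpCoeff_expMode hN l n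
    rw [interpCoeff] at this ⊢
    simp_rw [mul_assoc, ← Finset.mul_sum]
    rw [mul_left_comm, this, mul_ite, mul_one, mul_zero]
  simp_rw [e] at h
  have hinj : Function.Injective fun i : ℤ => n + 2 * N * i := fun i i' hi => by
    have : (2 * N : ℤ) ≠ 0 := by positivity
    simpa [this, hN.ne'] using hi
  rw [← hinj.hasSum_iff] at h
  · simpa [Function.comp_def] using h
  · intro l hl
    rw [if_neg]
    rintro ⟨i, hi⟩
    exact hl ⟨i, by simp only; linarith⟩

lemma enorm_sub_interpCoeff_le {N : ℕ} (hN : 0 < N) {g : ℝ → ℂ} {c : ℤ → ℂ}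
    (hg : ∀ t, HasSum (fun n => c n * expMode n t) (g t)) (n : ℤ) :
    ‖c n - interpCoeff N g n‖ₑ ≤ ∑' i : {i : ℤ // i ≠ 0}, ‖c (n + 2 * N * i)‖ₑ := by
  have h := hasSum_interpCoeff_alias hN hg n
  have h1 := h.summable.tsum_subtype_add_tsum_subtype_compl {0}
  rw [tsum_singleton (0 : ℤ) fun i : ℤ => c (n + 2 * N * i), h.tsum_eq] at h1
  rw [← h1]
  simp only [mul_zero, add_zero, sub_add_cancel_left, enorm_neg]
  exact enorm_tsum_le_tsum_enorm

lemma fcoeff_sub_trigInterp {g : ℝ → ℂ} (hg : Continuous g) (N : ℕ) (m : ℤ) :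
    fcoeff (fun t => g t - trigInterp N g t) m =
      fcoeff g m - if m ∈ Finset.Icc (-(N : ℤ) + 1) (N : ℤ) then interpCoeff N g m else 0 := by
  rw [fcoeff_sub hg (continuous_trigInterp N g)]
  simp_rw [funext (trigInterp_eq N g)]
  rw [fcoeff_finset_sum _ (fun n => by fun_prop)]
  simp [fcoeff_const_mul, fcoeff_expMode]

lemma summable_ne_zero_abs_rpow {b : ℝ} (hb : 1 < b) :
    Summable fun i : {i : ℤ // i ≠ 0} => |(i.1 : ℝ)| ^ (-b) :=
  (Real.summable_abs_int_rpow hb).comp_injective Subtype.val_injective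

lemma summable_freqWeight_rpow {b : ℝ} (hb : 1 < b) :
    Summable fun n : ℤ => freqWeight n ^ (-b) := by
  have h : Summable fun n : {n : ℤ // n ≠ 0} => freqWeight n.1 ^ (-b) :=
    (summable_ne_zero_abs_rpow hb).congr fun n => by rw [freqWeight_of_ne_zero n.2]
  exact (Set.finite_singleton (0 : ℤ)).summable_compl_iff.mp h

lemma summable_norm_of_summable_freqWeight {σ : ℝ} (hσ : 1 / 2 < σ) {c : ℤ → ℂ}
    (hs : Summable fun n => freqWeight n ^ (2 * σ) * ‖c n‖ ^ 2) : Summable fun n => ‖c n‖ := by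
  refine Summable.of_nonneg_of_le (fun n => norm_nonneg _) (fun n => ?_)
    ((summable_freqWeight_rpow (b := 2 * σ) (by linarith)).add hs)
  have hw := freqWeight_pos n
  have e1 : freqWeight n ^ (2 * σ) = (freqWeight n ^ σ) ^ 2 := by
    rw [← Real.rpow_natCast, ← Real.rpow_mul hw.le]; congr 1; push_cast; ring
  have h1 : 0 < freqWeight n ^ σ := by positivity
  rw [Real.rpow_neg hw.le, e1]
  have h2 : ‖c n‖ = (freqWeight n ^ σ)⁻¹ * (freqWeight n ^ σ * ‖c n‖) := by field_simp
  rw [← inv_pow, ← mul_pow, h2]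
  set x := (freqWeight n ^ σ)⁻¹
  rw [← h2]
  nlinarith [sq_nonneg (x - freqWeight n ^ σ * ‖c n‖), sq_nonneg (x + freqWeight n ^ σ * ‖c n‖)]

lemma exists_sobEnergy_psi2_conv_le {p q : ℝ} (hp : 3 ≤ p) (hq : -3 ≤ q) (hpq : 1 / 2 < p + q) :
    ∃ K : ℝ≥0∞, K ≠ ∞ ∧ ∀ N : ℕ, 0 < N → ∀ g : ℝ → ℂ, Continuous g →
      (∀ t, HasSum (fun n => fcoeff g n * expMode n t) (g t)) →
      sobEnergy p (fcoeff fun s =>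
          ∫ t in (0:ℝ)..(2 * π), psi2 (s - t) * (g t - trigInterp N g t)) ≤
        K * ENNReal.ofReal ((N : ℝ) ^ (-(2 * (q + 3)))) * sobEnergy (p + q) (fcoeff g) := by
  obtain ⟨C, hC, hpsi⟩ := exists_norm_fcoeff_psi2_le
  refine ⟨ENNReal.ofReal ((2 * π * C) ^ 2) * (1 + ∑' i : {i : ℤ // i ≠ 0},
    ENNReal.ofReal (|(i.1 : ℝ)| ^ (-(2 * (p + q))))), ENNReal.mul_ne_top ENNReal.ofReal_ne_top
      (ENNReal.add_ne_top.mpr ⟨ENNReal.one_ne_top,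
        (summable_ne_zero_abs_rpow (by linarith)).tsum_ofReal_ne_top⟩), ?_⟩
  intro N hN g hg hsum
  have hcont := continuous_trigInterp N g
  have h1 := sobEnergy_le_of_norm_le (p := p) (r := 3) (C := 2 * π * C)
    (f := fcoeff fun s => ∫ t in (0:ℝ)..(2 * π), psi2 (s - t) * (g t - trigInterp N g t))
    (e := fcoeff fun t => g t - trigInterp N g t) (fun n => by
      rw [fcoeff_convolution (h := fun t => g t - trigInterp N g t) continuous_psi2 psi2_periodic
        (by fun_prop), norm_mul, norm_mul]
      have h2pi : ‖(2 * (π : ℂ))‖ = 2 * π := by simp [abs_of_pos Real.pi_pos]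
      rw [h2pi, mul_assoc (2 * π) C]
      gcongr
      exact hpsi n)
  have h2 := sobEnergy_alias_le (r := p - 3) (s := q + 3) (by linarith) (by linarith) hN
    (d := fcoeff g) (e := fcoeff fun t => g t - trigInterp N g t)
    (fun m hm => by rw [fcoeff_sub_trigInterp hg, if_neg hm, sub_zero])
    (fun m hm => by
      rw [fcoeff_sub_trigInterp hg, if_pos hm]
      exact enorm_sub_interpCoeff_le hN hsum m)
  rw [show p - 3 + (q + 3) = p + q by ring] at h2
  refine h1.trans ((mul_le_mul_right h2 _).trans_eq ?_)
  ring

/-- Smooth functions of two variables that are `2π`-periodic in each of them. -/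
structure SmoothBiperiodic (a : ℝ → ℝ → ℂ) : Prop where
  contDiff : ContDiff ℝ (⊤ : ℕ∞) fun st : ℝ × ℝ => a st.1 st.2
  periodic_fst : ∀ s t, a (s + 2 * π) t = a s t
  periodic_snd : ∀ s t, a s (t + 2 * π) = a s t

/-- The double Fourier coefficient with frequency `j` in the first variable and `k` in the
second. -/
noncomputable def fcoeff₂ (a : ℝ → ℝ → ℂ) (j k : ℤ) : ℂ := fcoeff (fun s => fcoeff (a s) k) j

namespace SmoothBiperiodic

variable {a : ℝ → ℝ → ℂ}

lemma continuous_uncurry (h : SmoothBiperiodic a) : Continuous (Function.uncurry a) :=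
  h.contDiff.continuous

lemma swap (h : SmoothBiperiodic a) : SmoothBiperiodic fun s t => a t s :=
  ⟨h.contDiff.comp (contDiff_snd.prodMk contDiff_fst), fun s t => h.periodic_snd t s,
    fun s t => h.periodic_fst t s⟩

lemma hasDerivAt_fst (h : SmoothBiperiodic a) (s t : ℝ) :
    HasDerivAt (fun x => a x t) (fderiv ℝ (fun st : ℝ × ℝ => a st.1 st.2) (s, t) (1, 0)) s := by
  have h1 := ((h.contDiff.differentiable (by simp)) (s, t)).hasFDerivAt
  have h2 : HasDerivAt (fun x : ℝ => (x, t)) (1, 0) s :=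
    (hasDerivAt_id s).prodMk (hasDerivAt_const s t)
  exact h1.comp_hasDerivAt s h2

lemma deriv_fst (h : SmoothBiperiodic a) : SmoothBiperiodic fun s t => deriv (fun x => a x t) s := by
  refine ⟨?_, fun s t => ?_, fun s t => ?_⟩
  · simp_rw [(h.hasDerivAt_fst _ _).deriv]
    exact (h.contDiff.fderiv_right (m := (⊤ : ℕ∞)) (by simp)).clm_apply contDiff_const
  · rw [← deriv_comp_add_const]
    simp_rw [h.periodic_fst]
  · simp_rw [h.periodic_snd]

lemma fcoeff₂_swap (h : SmoothBiperiodic a) (j k : ℤ) :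
    fcoeff₂ (fun s t => a t s) j k = fcoeff₂ a k j :=
  fcoeff_swap (a := fun s t => a t s) h.swap.continuous_uncurry j k

lemma fcoeff₂_deriv_fst (h : SmoothBiperiodic a) (j k : ℤ) :
    fcoeff₂ (fun s t => deriv (fun x => a x t) s) j k = Complex.I * j * fcoeff₂ a j k := by
  rw [← h.deriv_fst.fcoeff₂_swap, ← h.fcoeff₂_swap, fcoeff₂, fcoeff₂, ← fcoeff_const_mul]
  congr 1; ext t
  have hc := h.deriv_fst.continuous_uncurry
  refine fcoeff_deriv (fun s => (h.hasDerivAt_fst s t).differentiableAt.hasDerivAt)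
    (hc.comp (by fun_prop : Continuous fun s : ℝ => (s, t))) (fun s => h.periodic_fst s t) j

lemma exists_norm_le (h : SmoothBiperiodic a) : ∃ B, ∀ s t, ‖a s t‖ ≤ B := by
  obtain ⟨B, hB⟩ := (isCompact_Icc.prod isCompact_Icc).exists_bound_of_continuousOn
    (h.continuous_uncurry.continuousOn (s := Icc 0 (2 * π) ×ˢ Icc 0 (2 * π)))
  refine ⟨B, fun s t => ?_⟩
  obtain ⟨s', hs', e1⟩ := Function.Periodic.exists_mem_Ico₀
    (f := fun s => a s t) (fun s => h.periodic_fst s t) Real.two_pi_pos s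
  obtain ⟨t', ht', e2⟩ := Function.Periodic.exists_mem_Ico₀
    (f := a s') (fun t => h.periodic_snd s' t) Real.two_pi_pos t
  rw [show a s t = a s' t from e1, e2]
  exact hB (s', t') ⟨Ico_subset_Icc_self hs', Ico_subset_Icc_self ht'⟩

lemma exists_pow_mul_norm_fcoeff₂_le (m : ℕ) : ∀ (n : ℕ) {a : ℝ → ℝ → ℂ}, SmoothBiperiodic a →
    ∃ B, ∀ j k : ℤ, |(j : ℝ)| ^ m * |(k : ℝ)| ^ n * ‖fcoeff₂ a j k‖ ≤ B := by
  induction m with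
  | zero =>
    intro n
    induction n with
    | zero =>
      intro a h
      obtain ⟨B, hB⟩ := h.exists_norm_le
      refine ⟨B, fun j k => ?_⟩
      simpa [fcoeff₂] using norm_fcoeff_le (fun s => norm_fcoeff_le (hB s) k) j
    | succ n ih =>
      intro a h
      obtain ⟨B, hB⟩ := ih h.swap.deriv_fst.swap
      refine ⟨B, fun j k => (le_of_eq ?_).trans (hB j k)⟩
      rw [h.swap.deriv_fst.fcoeff₂_swap, h.swap.fcoeff₂_deriv_fst, h.fcoeff₂_swap]
      simp [pow_succ, mul_assoc]
  | succ m ih =>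
    intro n a h
    obtain ⟨B, hB⟩ := ih n h.deriv_fst
    refine ⟨B, fun j k => (le_of_eq ?_).trans (hB j k)⟩
    rw [h.fcoeff₂_deriv_fst]
    simp only [norm_mul, Complex.norm_I, Complex.norm_intCast, one_mul]
    ring

lemma exists_freqWeight_pow_mul_norm_fcoeff₂_le (h : SmoothBiperiodic a) (M : ℕ) :
    ∃ B, 0 ≤ B ∧ ∀ j k, freqWeight j ^ M * freqWeight k ^ M * ‖fcoeff₂ a j k‖ ≤ B := by
  obtain ⟨B₁, h₁⟩ := exists_pow_mul_norm_fcoeff₂_le 0 0 h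
  obtain ⟨B₂, h₂⟩ := exists_pow_mul_norm_fcoeff₂_le M 0 h
  obtain ⟨B₃, h₃⟩ := exists_pow_mul_norm_fcoeff₂_le 0 M h
  obtain ⟨B₄, h₄⟩ := exists_pow_mul_norm_fcoeff₂_le M M h
  have key : ∀ j k, freqWeight j ^ M * freqWeight k ^ M * ‖fcoeff₂ a j k‖ ≤ B₁ + B₂ + B₃ + B₄ :=
    fun j k => by
    have hw : ∀ n, freqWeight n ^ M ≤ 1 + |(n : ℝ)| ^ M := fun n => by
      rcases max_choice 1 |(n : ℝ)| with e | e <;> rw [freqWeight, e]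
      · simp
      · simp
    have := freqWeight_pos k
    calc _ ≤ (1 + |(j : ℝ)| ^ M) * (1 + |(k : ℝ)| ^ M) * ‖fcoeff₂ a j k‖ := by
          gcongr <;> exact hw _
      _ = |(j : ℝ)| ^ 0 * |(k : ℝ)| ^ 0 * ‖fcoeff₂ a j k‖ +
          |(j : ℝ)| ^ M * |(k : ℝ)| ^ 0 * ‖fcoeff₂ a j k‖ +
          |(j : ℝ)| ^ 0 * |(k : ℝ)| ^ M * ‖fcoeff₂ a j k‖ +
          |(j : ℝ)| ^ M * |(k : ℝ)| ^ M * ‖fcoeff₂ a j k‖ := by ring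
      _ ≤ _ := add_le_add (add_le_add (add_le_add (h₁ j k) (h₂ j k)) (h₃ j k)) (h₄ j k)
  refine ⟨_, le_trans ?_ (key 0 0), key⟩
  simp

lemma summable_fcoeff₂ (h : SmoothBiperiodic a) (b : ℝ) :
    Summable fun x : ℤ × ℤ => ‖fcoeff₂ a x.2 x.1‖ * freqWeight x.2 ^ b * freqWeight x.1 ^ b := by
  obtain ⟨M, hM⟩ := exists_nat_ge (b + 2)
  obtain ⟨B, hB0, hB⟩ := h.exists_freqWeight_pow_mul_norm_fcoeff₂_le M
  have hs := summable_freqWeight_rpow (b := 2) (by norm_num)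
  have hn : 0 ≤ fun n : ℤ => freqWeight n ^ (-2 : ℝ) := fun n => by
    have := freqWeight_pos n
    positivity
  refine Summable.of_nonneg_of_le (fun x => ?_) (fun x => ?_)
    ((hs.mul_of_nonneg hs hn hn).mul_left B)
  · have := freqWeight_pos x.1
    have := freqWeight_pos x.2
    positivity
  · obtain ⟨k, j⟩ := x
    have hj := freqWeight_pos j
    have hk := freqWeight_pos k
    have hb : ∀ n, freqWeight n ^ b ≤ freqWeight n ^ M * freqWeight n ^ (-2 : ℝ) := fun n => by
      rw [← Real.rpow_natCast, ← Real.rpow_add (freqWeight_pos n)]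
      exact Real.rpow_le_rpow_of_exponent_le (one_le_freqWeight n) (by linarith)
    simp only
    calc _ ≤ ‖fcoeff₂ a j k‖ * (freqWeight j ^ M * freqWeight j ^ (-2 : ℝ)) *
          (freqWeight k ^ M * freqWeight k ^ (-2 : ℝ)) := by gcongr <;> exact hb _
      _ = (freqWeight j ^ M * freqWeight k ^ M * ‖fcoeff₂ a j k‖) *
          (freqWeight k ^ (-2 : ℝ) * freqWeight j ^ (-2 : ℝ)) := by ring
      _ ≤ _ := by gcongr; exact hB j k

lemma summable_norm_fcoeff₂ (h : SmoothBiperiodic a) :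
    Summable fun x : ℤ × ℤ => ‖fcoeff₂ a x.2 x.1‖ := by
  simpa using h.summable_fcoeff₂ 0

lemma hasSum_fcoeff₂ (h : SmoothBiperiodic a) (s t : ℝ) :
    HasSum (fun x : ℤ × ℤ => fcoeff₂ a x.2 x.1 * expMode x.2 s * expMode x.1 t) (a s t) := by
  have hc := h.continuous_uncurry
  have hs := h.summable_norm_fcoeff₂
  have inner : ∀ k, HasSum (fun j => fcoeff₂ a j k * expMode j s) (fcoeff (a s) k) := fun k => by
    refine hasSum_fcoeff (f := fun s => fcoeff (a s) k) ?_ (fun s => ?_) (hs.prod_factor k) s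
    · simp_rw [fcoeff_eq]
      refine continuous_const.mul
        (intervalIntegral.continuous_parametric_intervalIntegral_of_continuous' ?_ _ _)
      unfold Function.uncurry at *
      fun_prop
    · simp only
      rw [show a (s + 2 * π) = a s from funext fun t => h.periodic_fst s t]
  have outer : HasSum (fun k => fcoeff (a s) k * expMode k t) (a s t) := by
    refine hasSum_fcoeff (f := a s) (hc.comp (by fun_prop : Continuous fun t : ℝ => (s, t)))
      (h.periodic_snd s) ?_ t
    refine Summable.of_nonneg_of_le (fun k => norm_nonneg _) (fun k => ?_) hs.prod
    rw [← (inner k).tsum_eq]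
    refine (norm_tsum_le_tsum_norm ?_).trans_eq ?_
    · simpa using hs.prod_factor k
    · simp
  have total : Summable fun x : ℤ × ℤ => fcoeff₂ a x.2 x.1 * expMode x.2 s * expMode x.1 t :=
    Summable.of_norm (by simpa using hs)
  have h2 := total.hasSum.prod_fiberwise fun k => (inner k).mul_right (expMode k t)
  rw [outer.unique h2]
  exact total.hasSum

end SmoothBiperiodic

lemma exists_norm_le_of_periodic {f : ℝ → ℂ} (hf : Continuous f)
    (hper : Function.Periodic f (2 * π)) : ∃ B, ∀ t, ‖f t‖ ≤ B := by
  obtain ⟨B, hB⟩ := isCompact_Icc.exists_bound_of_continuousOn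
    (hf.continuousOn (s := Icc 0 (2 * π)))
  refine ⟨B, fun t => ?_⟩
  obtain ⟨t', ht', e⟩ := hper.exists_mem_Ico₀ Real.two_pi_pos t
  rw [e]
  exact hB t' (Ico_subset_Icc_self ht')

/-- The quadrature error `(ψ₂ * (g - P_N g))(s)`. -/
noncomputable def psi2Error (N : ℕ) (g : ℝ → ℂ) (s : ℝ) : ℂ :=
  ∫ t in (0:ℝ)..(2 * π), psi2 (s - t) * (g t - trigInterp N g t)

lemma psi2Error_eq (N : ℕ) {g : ℝ → ℂ} (hg : Continuous g) (s : ℝ) :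
    psi2Error N g s = (∫ t in (0:ℝ)..(2 * π), psi2 (s - t) * g t) -
      ∫ t in (0:ℝ)..(2 * π), psi2 (s - t) * trigInterp N g t := by
  have hc := continuous_trigInterp N g
  have hpsi := continuous_psi2
  rw [← intervalIntegral.integral_sub (Continuous.intervalIntegrable (by fun_prop) _ _)
    (Continuous.intervalIntegrable (by fun_prop) _ _)]
  simp_rw [psi2Error, mul_sub]

lemma continuous_psi2Error (N : ℕ) {g : ℝ → ℂ} (hg : Continuous g) :
    Continuous (psi2Error N g) := by
  have hc := continuous_trigInterp N g
  have hpsi := continuous_psi2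
  refine intervalIntegral.continuous_parametric_intervalIntegral_of_continuous' ?_ _ _
  unfold Function.uncurry
  fun_prop

lemma norm_psi2_mul_sub_trigInterp_le {N : ℕ} (hN : 0 < N) {P B : ℝ} (hP : ∀ t, ‖psi2 t‖ ≤ P)
    {g : ℝ → ℂ} (hg : ∀ t, ‖g t‖ ≤ B) (s t : ℝ) :
    ‖psi2 (s - t) * (g t - trigInterp N g t)‖ ≤
      P * (B + (Finset.Icc (-(N : ℤ) + 1) (N : ℤ)).card * B) := by
  have : 0 ≤ P := (norm_nonneg _).trans (hP 0)
  rw [norm_mul]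
  gcongr
  · exact hP _
  · exact (norm_sub_le _ _).trans (add_le_add (hg t) (norm_trigInterp_le hN hg t))

lemma norm_psi2Error_le {N : ℕ} (hN : 0 < N) {P B : ℝ} (hP : ∀ t, ‖psi2 t‖ ≤ P)
    {g : ℝ → ℂ} (hg : ∀ t, ‖g t‖ ≤ B) (s : ℝ) :
    ‖psi2Error N g s‖ ≤ P * (B + (Finset.Icc (-(N : ℤ) + 1) (N : ℤ)).card * B) * (2 * π) := by
  refine (intervalIntegral.norm_integral_le_of_norm_le_const fun t _ =>
    norm_psi2_mul_sub_trigInterp_le hN hP hg s t).trans_eq ?_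
  rw [sub_zero, abs_of_pos Real.two_pi_pos]

namespace SmoothBiperiodic

variable {a : ℝ → ℝ → ℂ}

lemma hasSum_psi2Error (h : SmoothBiperiodic a) {N : ℕ} (hN : 0 < N) {φ : ℝ → ℂ}
    (hφ : Continuous φ) {B : ℝ} (hB : ∀ t, ‖φ t‖ ≤ B) (s : ℝ) :
    HasSum (fun x : ℤ × ℤ => fcoeff₂ a x.2 x.1 *
        (expMode x.2 s * psi2Error N (fun t => expMode x.1 t * φ t) s))
      (psi2Error N (fun t => a s t * φ t) s) := by
  obtain ⟨P, hP⟩ := exists_norm_le_of_periodic continuous_psi2 psi2_periodic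
  have hpsi := continuous_psi2
  have hsum : ∀ t, HasSum (fun x : ℤ × ℤ =>
      (fcoeff₂ a x.2 x.1 * expMode x.2 s) * (expMode x.1 t * φ t)) (a s t * φ t) := fun t => by
    simpa [mul_assoc] using (h.hasSum_fcoeff₂ s t).mul_right (φ t)
  have key : ∀ t, HasSum (fun x : ℤ × ℤ => (fcoeff₂ a x.2 x.1 * expMode x.2 s) *
      (psi2 (s - t) * (expMode x.1 t * φ t - trigInterp N (fun t => expMode x.1 t * φ t) t)))
      (psi2 (s - t) * (a s t * φ t - trigInterp N (fun t => a s t * φ t) t)) := fun t => by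
    have := ((hsum t).sub (hasSum_trigInterp hsum N t)).mul_left (psi2 (s - t))
    simp_rw [trigInterp_const_mul, ← mul_sub, mul_left_comm (psi2 _)] at this
    exact this
  have hint := hasSum_intervalIntegral_of_le (fun x => ?_) (h.summable_norm_fcoeff₂.mul_right
    (P * (B + (Finset.Icc (-(N : ℤ) + 1) (N : ℤ)).card * B))) (fun x t => ?_) key
  · simp_rw [intervalIntegral.integral_const_mul, mul_assoc] at hint
    exact hint
  · have := continuous_trigInterp N (fun t => expMode x.1 t * φ t)
    fun_prop
  · rw [norm_mul, norm_mul, norm_expMode, mul_one]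
    gcongr
    exact norm_psi2_mul_sub_trigInterp_le hN hP (g := fun t => expMode x.1 t * φ t)
      (by simpa using hB) s t

lemma enorm_fcoeff_psi2Error_le (h : SmoothBiperiodic a) {N : ℕ} (hN : 0 < N) {φ : ℝ → ℂ}
    (hφ : Continuous φ) {B : ℝ} (hB : ∀ t, ‖φ t‖ ≤ B) (l : ℤ) :
    ‖fcoeff (fun s => psi2Error N (fun t => a s t * φ t) s) l‖ₑ ≤
      ∑' x : ℤ × ℤ, ‖fcoeff₂ a x.2 x.1‖ₑ *
        ‖fcoeff (psi2Error N fun t => expMode x.1 t * φ t) (l - x.2)‖ₑ := by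
  obtain ⟨P, hP⟩ := exists_norm_le_of_periodic continuous_psi2 psi2_periodic
  have hsum := hasSum_fcoeff_of_le (fun x => ?_) (h.summable_norm_fcoeff₂.mul_right
    (P * (B + (Finset.Icc (-(N : ℤ) + 1) (N : ℤ)).card * B) * (2 * π))) (fun x s => ?_)
    (fun s => h.hasSum_psi2Error hN hφ hB s) l
  · simp_rw [fcoeff_const_mul, fcoeff_expMode_mul] at hsum
    rw [← hsum.tsum_eq]
    refine enorm_tsum_le_tsum_enorm.trans_eq ?_
    simp_rw [enorm_mul]
  · have := continuous_psi2Error N (g := fun t => expMode x.1 t * φ t) (by fun_prop)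
    fun_prop
  · rw [norm_mul, norm_mul, norm_expMode, one_mul]
    gcongr
    exact norm_psi2Error_le hN hP (g := fun t => expMode x.1 t * φ t) (by simpa using hB) s

lemma tsum_enorm_fcoeff₂_mul_ne_top (h : SmoothBiperiodic a) (b c : ℝ) :
    ∑' x : ℤ × ℤ, ‖fcoeff₂ a x.2 x.1‖ₑ * (ENNReal.ofReal ((2 * freqWeight x.2) ^ b) *
      ENNReal.ofReal ((2 * freqWeight x.1) ^ c)) ≠ ∞ := by
  have hs := ((h.summable_fcoeff₂ (max b c)).mul_right (2 ^ b * 2 ^ c)).tsum_ofReal_ne_top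
  refine ne_top_of_le_ne_top hs (ENNReal.tsum_le_tsum fun x => ?_)
  have h1 := freqWeight_pos x.1
  have h2 := freqWeight_pos x.2
  rw [← ofReal_norm, ← ENNReal.ofReal_mul (by positivity), ← ENNReal.ofReal_mul (by positivity)]
  refine ENNReal.ofReal_le_ofReal ?_
  rw [Real.mul_rpow (by norm_num) h1.le, Real.mul_rpow (by norm_num) h2.le]
  calc _ = ‖fcoeff₂ a x.2 x.1‖ * freqWeight x.2 ^ b * freqWeight x.1 ^ c * (2 ^ b * 2 ^ c) := by
        ring
    _ ≤ _ := by
        gcongr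
        · exact one_le_freqWeight _
        · exact le_max_left _ _
        · exact one_le_freqWeight _
        · exact le_max_right _ _

lemma tsum_enorm_fcoeff₂_ne_top (h : SmoothBiperiodic a) :
    ∑' x : ℤ × ℤ, ‖fcoeff₂ a x.2 x.1‖ₑ ≠ ∞ := by
  simpa using h.tsum_enorm_fcoeff₂_mul_ne_top 0 0

lemma exists_sobEnergy_psi2Error_le (h : SmoothBiperiodic a) {p q : ℝ} (hp : 3 ≤ p) (hq : -3 ≤ q)
    (hpq : 1 / 2 < p + q) : ∃ K : ℝ≥0∞, K ≠ ∞ ∧ ∀ N : ℕ, 0 < N → ∀ φ : ℝ → ℂ, Continuous φ →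
      Function.Periodic φ (2 * π) →
      (Summable fun n => freqWeight n ^ (2 * (p + q)) * ‖fcoeff φ n‖ ^ 2) →
      sobEnergy p (fcoeff fun s => psi2Error N (fun t => a s t * φ t) s) ≤
        K * ENNReal.ofReal ((N : ℝ) ^ (-(2 * (q + 3)))) * sobEnergy (p + q) (fcoeff φ) := by
  obtain ⟨K, hK, hconv⟩ := exists_sobEnergy_psi2_conv_le hp hq hpq
  refine ⟨(∑' x : ℤ × ℤ, ‖fcoeff₂ a x.2 x.1‖ₑ) * ((∑' x : ℤ × ℤ, ‖fcoeff₂ a x.2 x.1‖ₑ *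
    (ENNReal.ofReal ((2 * freqWeight x.2) ^ (2 * p)) *
      ENNReal.ofReal ((2 * freqWeight x.1) ^ (2 * (p + q))))) * K),
    ENNReal.mul_ne_top h.tsum_enorm_fcoeff₂_ne_top
      (ENNReal.mul_ne_top (h.tsum_enorm_fcoeff₂_mul_ne_top _ _) hK), ?_⟩
  intro N hN φ hφ hper hs
  obtain ⟨B, hB⟩ := exists_norm_le_of_periodic hφ hper
  have hnorm := summable_norm_of_summable_freqWeight hpq hs
  have hmode : ∀ k, sobEnergy p (fcoeff (psi2Error N fun t => expMode k t * φ t)) ≤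
      K * ENNReal.ofReal ((N : ℝ) ^ (-(2 * (q + 3)))) *
        (ENNReal.ofReal ((2 * freqWeight k) ^ (2 * (p + q))) * sobEnergy (p + q) (fcoeff φ)) :=
    fun k => by
    have hcoeff : fcoeff (fun t => expMode k t * φ t) = fun m => fcoeff φ (m - k) :=
      funext fun m => fcoeff_expMode_mul k φ m
    refine (hconv N hN (fun t => expMode k t * φ t) (by fun_prop) ?_).trans ?_
    · refine hasSum_fcoeff (by fun_prop) ((expMode_periodic k).mul hper) ?_
      rw [hcoeff]
      exact hnorm.comp_injective (sub_left_injective (b := k))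
    · rw [hcoeff]
      gcongr
      exact sobEnergy_shift_le (by linarith) _ k
  refine (sobEnergy_superposition_le (by linarith)
    (fun l => h.enorm_fcoeff_psi2Error_le hN hφ hB l)).trans ?_
  simp_rw [mul_assoc]
  gcongr
  rw [← ENNReal.tsum_mul_right]
  refine ENNReal.tsum_le_tsum fun x => ?_
  calc _ ≤ _ := mul_le_mul_right (mul_le_mul_right (hmode x.1) _) _
    _ = _ := by ring

end SmoothBiperiodic

lemma exists_sobNorm_le_of_sobEnergy_le {K : ℝ≥0∞} (hK : K ≠ ∞) :
    ∃ C > (0 : ℝ), ∀ {p σ r x : ℝ} {c d : ℤ → ℂ}, 0 ≤ x →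
      (Summable fun n => freqWeight n ^ (2 * σ) * ‖c n‖ ^ 2) →
      sobEnergy p d ≤ K * ENNReal.ofReal (x ^ (-(2 * r))) * sobEnergy σ c →
      sobNorm p d ≤ C * x ^ (-r) * sobNorm σ c := by
  refine ⟨√K.toReal + 1, by positivity, fun {p σ r x c d} hx hs h => ?_⟩
  have hn : 0 ≤ sobNorm σ c := Real.sqrt_nonneg _
  refine sobNorm_le_of_sobEnergy_le (by positivity) (h.trans ?_)
  rw [sobEnergy_eq hs, ← ENNReal.ofReal_toReal hK, ← ENNReal.ofReal_mul (by positivity),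
    ← ENNReal.ofReal_mul (by positivity)]
  refine ENNReal.ofReal_le_ofReal ?_
  rw [mul_pow, mul_pow, ENNReal.toReal_ofReal (by positivity), ← Real.rpow_mul_natCast hx,
    show -r * (2 : ℕ) = -(2 * r) by push_cast; ring]
  gcongr
  nlinarith [Real.sq_sqrt (ENNReal.toReal_nonneg (a := K)), Real.sqrt_nonneg K.toReal]

end

/-- quadrature error for the weight `ψ₂`: with
`Ψ₂φ(s) = ∫₀^{2π} ψ₂(s-t)a(s,t)φ(t)dt` and
`Ψ₂,Nφ(s) = ∫₀^{2π} ψ₂(s-t) P_N[a(s,·)φ](t)dt`, for `q ≥ -3`, `p + q > 1/2` one has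
`‖(Ψ₂-Ψ₂,N)φ‖_p ≤ C N^{-q-3}‖φ‖_{p+q}` if `p ≥ 3`, and
`‖(Ψ₂-Ψ₂,N)φ‖_p ≤ C N^{-p-q}‖φ‖_{p+q}` if `0 ≤ p ≤ 3`. -/
theorem quadrature_error_psi2 (a : ℝ → ℝ → ℂ)
    (ha : ContDiff ℝ (⊤ : ℕ∞) (fun st : ℝ × ℝ => a st.1 st.2))
    (hper₁ : ∀ s t : ℝ, a (s + 2 * π) t = a s t)
    (hper₂ : ∀ s t : ℝ, a s (t + 2 * π) = a s t)
    (p q : ℝ) (hq : -3 ≤ q) (hpq : 1 / 2 < p + q) :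
    (3 ≤ p → ∃ C > (0:ℝ), ∀ N : ℕ, 0 < N → ∀ φ : ℝ → ℂ, Continuous φ →
      Function.Periodic φ (2 * π) →
      Summable (fun n : {n : ℤ // n ≠ 0} =>
        |(n.1 : ℝ)| ^ (2 * (p + q)) * ‖fcoeff φ n.1‖ ^ 2) →
      sobNormF p (fun s =>
          (∫ t in (0:ℝ)..(2 * π), psi2 (s - t) * (a s t * φ t)) -
            ∫ t in (0:ℝ)..(2 * π), psi2 (s - t) * trigInterp N (fun u => a s u * φ u) t) ≤
        C * (N : ℝ) ^ (-(q + 3)) * sobNormF (p + q) φ) ∧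
    (0 ≤ p → p ≤ 3 → ∃ C > (0:ℝ), ∀ N : ℕ, 0 < N → ∀ φ : ℝ → ℂ, Continuous φ →
      Function.Periodic φ (2 * π) →
      Summable (fun n : {n : ℤ // n ≠ 0} =>
        |(n.1 : ℝ)| ^ (2 * (p + q)) * ‖fcoeff φ n.1‖ ^ 2) →
      sobNormF p (fun s =>
          (∫ t in (0:ℝ)..(2 * π), psi2 (s - t) * (a s t * φ t)) -
            ∫ t in (0:ℝ)..(2 * π), psi2 (s - t) * trigInterp N (fun u => a s u * φ u) t) ≤
        C * (N : ℝ) ^ (-(p + q)) * sobNormF (p + q) φ) := by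
  have h : SmoothBiperiodic a := ⟨ha, hper₁, hper₂⟩
  have hrow : ∀ s, Continuous (a s) := fun s =>
    h.continuous_uncurry.comp (by fun_prop : Continuous fun t : ℝ => (s, t))
  have herr : ∀ (N : ℕ) {φ : ℝ → ℂ}, Continuous φ → ∀ s,
      psi2Error N (fun t => a s t * φ t) s =
        (∫ t in (0:ℝ)..(2 * π), psi2 (s - t) * (a s t * φ t)) -
          ∫ t in (0:ℝ)..(2 * π), psi2 (s - t) * trigInterp N (fun u => a s u * φ u) t :=
    fun N φ hφ s => psi2Error_eq N ((hrow s).mul hφ) s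
  constructor
  · intro hp
    obtain ⟨K, hK, hE⟩ := h.exists_sobEnergy_psi2Error_le hp hq hpq
    obtain ⟨C, hC, hle⟩ := exists_sobNorm_le_of_sobEnergy_le hK
    refine ⟨C, hC, fun N hN φ hφ hper hs => ?_⟩
    simp_rw [← herr N hφ]
    have hs' := summable_freqWeight_of_summable hs
    exact hle N.cast_nonneg hs' (hE N hN φ hφ hper hs')
  · intro _ hp3
    have hsum : 3 + (p + q - 3) = p + q := by ring
    obtain ⟨K, hK, hE⟩ := h.exists_sobEnergy_psi2Error_le (p := 3) (q := p + q - 3) le_rfl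
      (by linarith) (by linarith)
    rw [hsum, sub_add_cancel] at hE
    obtain ⟨C, hC, hle⟩ := exists_sobNorm_le_of_sobEnergy_le hK
    refine ⟨C, hC, fun N hN φ hφ hper hs => ?_⟩
    simp_rw [← herr N hφ]
    have hs' := summable_freqWeight_of_summable hs
    exact hle N.cast_nonneg hs' ((sobEnergy_mono hp3 _).trans (hE N hN φ hφ hper hs'))
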